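/- There exist s₁ > 0 and C > 0, depending only on a, p, n, μ, such that for every function w : ℝⁿ × [s₀, ∞) → ℝ of class C² in y and C¹ in s solving equation (W), with w, ∇w and ∂_s w bounded on ℝⁿ × [s₁', s₂'] for all s₀ ≤ s₁' < s₂', and for all s ≥ max{s₁, s₀}: ∫_{ℝⁿ} |w(y,s)|^{p+1} ρ(y) dy ≤ (4(p+1)/(p-1)) E[w](s) + (1/2) ∫_{ℝⁿ} (∂_s w(y,s))² ρ(y) dy + C. -/

import Mathlib

open MeasureTheory Real Filter Topology

noncomputable def hfun (p a μ : ℝ) (z : ℝ) : ℝ :=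
  μ * |z| ^ (p - 1) * z / (Real.log (2 + z ^ 2)) ^ a

noncomputable def Hfun (p a μ : ℝ) (z : ℝ) : ℝ :=
  ∫ ξ in (0:ℝ)..z, hfun p a μ ξ

noncomputable def rho (n : ℕ) (y : EuclideanSpace ℝ (Fin n)) : ℝ :=
  (4 * Real.pi) ^ (-(n : ℝ) / 2) * Real.exp (-‖y‖ ^ 2 / 4)

/-- The Laplacian of `f`, written as the sum of second derivatives in the coordinate
directions. -/
noncomputable def lap (n : ℕ) (f : EuclideanSpace ℝ (Fin n) → ℝ)
    (y : EuclideanSpace ℝ (Fin n)) : ℝ :=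
  ∑ i : Fin n, fderiv ℝ (fun z => fderiv ℝ f z (EuclideanSpace.single i 1)) y
      (EuclideanSpace.single i 1)

/-- `w` is a classical solution of equation (W):
`∂ₛ w = Δw - (y/2)·∇w - w/(p-1) + |w|^(p-1) w + e^(-ps/(p-1)) h(e^(s/(p-1)) w)`,
of class `C²` in `y` and `C¹` in `s`, on `ℝⁿ × [s₀, ∞)`. -/
def SolvesW (n : ℕ) (p a μ s₀ : ℝ) (w : EuclideanSpace ℝ (Fin n) → ℝ → ℝ) : Prop :=
  (∀ s, s₀ ≤ s → ContDiff ℝ 2 (fun y => w y s)) ∧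
  (∀ y, ∀ s, s₀ ≤ s → DifferentiableAt ℝ (fun s' => w y s') s) ∧
  (∀ y, ∀ s, s₀ ≤ s →
    deriv (fun s' => w y s') s =
      lap n (fun z => w z s) y - (1 / 2) * fderiv ℝ (fun z => w z s) y y
        - w y s / (p - 1) + |w y s| ^ (p - 1) * w y s
        + Real.exp (-p * s / (p - 1)) * hfun p a μ (Real.exp (s / (p - 1)) * w y s))

/-- `w`, `∇w` and `∂ₛ w` are bounded on `ℝⁿ × [s₁, s₂]` for all `s₀ ≤ s₁ < s₂`. -/
def BoundedW (n : ℕ) (s₀ : ℝ) (w : EuclideanSpace ℝ (Fin n) → ℝ → ℝ) : Prop :=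
  ∀ s₁ s₂ : ℝ, s₀ ≤ s₁ → s₁ < s₂ → ∃ M : ℝ, ∀ y, ∀ s ∈ Set.Icc s₁ s₂,
    |w y s| ≤ M ∧ ‖fderiv ℝ (fun z => w z s) y‖ ≤ M ∧ |deriv (fun s' => w y s') s| ≤ M

noncomputable def Enat0 (n : ℕ) (p : ℝ) (w : EuclideanSpace ℝ (Fin n) → ℝ → ℝ) (s : ℝ) : ℝ :=
  ∫ y, ((1 / 2) * ‖fderiv ℝ (fun z => w z s) y‖ ^ 2 + (w y s) ^ 2 / (2 * (p - 1))
      - |w y s| ^ (p + 1) / (p + 1)) * rho n y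

noncomputable def Ipert (n : ℕ) (p a μ : ℝ) (w : EuclideanSpace ℝ (Fin n) → ℝ → ℝ)
    (s : ℝ) : ℝ :=
  -Real.exp (-(p + 1) * s / (p - 1)) *
    ∫ y, Hfun p a μ (Real.exp (s / (p - 1)) * w y s) * rho n y

noncomputable def Etot (n : ℕ) (p a μ : ℝ) (w : EuclideanSpace ℝ (Fin n) → ℝ → ℝ)
    (s : ℝ) : ℝ :=
  Enat0 n p w s + Ipert n p a μ w s

/-- The divergence theorem on the whole space, for an integrable `C¹` vector field whose
divergence is integrable. -/
lemma integral_divergence_eq_zero {n : ℕ} {F : Fin n → EuclideanSpace ℝ (Fin n) → ℝ}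
    (hF : ∀ i, ContDiff ℝ 1 (F i)) (hFint : ∀ i, Integrable (F i))
    (hdiv : Integrable fun y => ∑ i, fderiv ℝ (F i) y (EuclideanSpace.single i 1)) :
    ∫ y, ∑ i, fderiv ℝ (F i) y (EuclideanSpace.single i 1) = 0 := by
  let f : ContDiffBump (0 : EuclideanSpace ℝ (Fin n)) := ⟨1, 2, one_pos, one_lt_two⟩
  have hfc : ContDiff ℝ 1 f := f.contDiff
  have hf'c : Continuous (fderiv ℝ f) := hfc.continuous_fderiv one_ne_zero
  obtain ⟨K, hK⟩ := (f.hasCompactSupport.fderiv (𝕜 := ℝ)).exists_bound_of_continuous hf'c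
  let c : ℕ → ℝ := fun k => ((k : ℝ) + 1)⁻¹
  have hcpos : ∀ k, 0 < c k := fun k => by positivity
  have hc0 : Tendsto c atTop (𝓝 0) := by
    simpa [c] using tendsto_one_div_add_atTop_nhds_zero_nat (𝕜 := ℝ)
  let φ : ℕ → EuclideanSpace ℝ (Fin n) → ℝ := fun k y => f (c k • y)
  have hφc : ∀ k, ContDiff ℝ 1 (φ k) := fun k => hfc.comp (contDiff_const_smul _)
  have hφd : ∀ k y v, fderiv ℝ (φ k) y v = c k * fderiv ℝ f (c k • y) v := by
    intro k y v
    have h := ((hfc.differentiable one_ne_zero (c k • y)).hasFDerivAt.comp y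
      ((hasFDerivAt_id y).const_smul (c k))).fderiv
    change fderiv ℝ (fun z => f (c k • z)) y v = _
    have h2 : fderiv ℝ (fun z => f (c k • z)) y = _ := h
    rw [h2]
    simp
  have hφs : ∀ k, HasCompactSupport (φ k) := fun k =>
    f.hasCompactSupport.comp_homeomorph (Homeomorph.smulOfNeZero (c k) (hcpos k).ne')
  have hF' : ∀ i, Continuous fun y => fderiv ℝ (F i) y (EuclideanSpace.single i 1) := fun i =>
    ((hF i).continuous_fderiv one_ne_zero).clm_apply continuous_const
  have hφ' : ∀ k (v : EuclideanSpace ℝ (Fin n)), Continuous fun y => fderiv ℝ (φ k) y v :=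
    fun k v => ((hφc k).continuous_fderiv one_ne_zero).clm_apply continuous_const
  have hI1 : ∀ k i, Integrable fun y =>
      φ k y * fderiv ℝ (F i) y (EuclideanSpace.single i 1) := fun k i =>
    ((hφc k).continuous.mul (hF' i)).integrable_of_hasCompactSupport (hφs k).mul_right
  have hI2 : ∀ k i, Integrable fun y =>
      fderiv ℝ (φ k) y (EuclideanSpace.single i 1) * F i y := fun k i =>
    ((hφ' k _).mul (hF i).continuous).integrable_of_hasCompactSupport
      ((hφs k).fderiv_apply (𝕜 := ℝ) _).mul_right
  have hparts : ∀ k, ∫ y, φ k y * ∑ i, fderiv ℝ (F i) y (EuclideanSpace.single i 1)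
      = - ∑ i, ∫ y, fderiv ℝ (φ k) y (EuclideanSpace.single i 1) * F i y := by
    intro k
    simp_rw [Finset.mul_sum]
    rw [integral_finsetSum _ fun i _ => hI1 k i, ← Finset.sum_neg_distrib]
    refine Finset.sum_congr rfl fun i _ => ?_
    exact integral_mul_fderiv_eq_neg_fderiv_mul_of_integrable (hI2 k i) (hI1 k i)
      (((hφc k).continuous.mul (hF i).continuous).integrable_of_hasCompactSupport
        (hφs k).mul_right)
      (fun x _ => (hφc k).differentiable one_ne_zero x)
      (fun x _ => (hF i).differentiable one_ne_zero x)
  have hlim1 : Tendsto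
      (fun k => ∫ y, φ k y * ∑ i, fderiv ℝ (F i) y (EuclideanSpace.single i 1)) atTop
      (𝓝 (∫ y, ∑ i, fderiv ℝ (F i) y (EuclideanSpace.single i 1))) := by
    refine tendsto_integral_of_dominated_convergence
      (fun y => ‖∑ i, fderiv ℝ (F i) y (EuclideanSpace.single i 1)‖)
      (fun k => ((hφc k).continuous.mul
        (continuous_finsetSum _ fun i _ => hF' i)).aestronglyMeasurable) hdiv.norm ?_ ?_
    · refine fun k => ae_of_all _ fun y => ?_
      rw [norm_mul]
      refine mul_le_of_le_one_left (norm_nonneg _) ?_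
      rw [Real.norm_of_nonneg f.nonneg]
      exact f.le_one
    · refine ae_of_all _ fun y => ?_
      have h1 : Tendsto (fun k => φ k y) atTop (𝓝 1) := by
        have h2 : Tendsto (fun k => c k • y) atTop (𝓝 0) := by
          simpa using hc0.smul_const y
        have h3 := (f.continuous.tendsto 0).comp h2
        rwa [f.one_of_mem_closedBall (by simp [f])] at h3
      simpa using h1.mul_const (∑ i, fderiv ℝ (F i) y (EuclideanSpace.single i 1))
  have hlim2 : Tendsto
      (fun k => - ∑ i, ∫ y, fderiv ℝ (φ k) y (EuclideanSpace.single i 1) * F i y) atTop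
      (𝓝 0) := by
    rw [← neg_zero, ← Finset.sum_const_zero (s := (Finset.univ : Finset (Fin n)))]
    refine (tendsto_finsetSum _ fun i _ => ?_).neg
    refine squeeze_zero_norm (a := fun k => c k * (K * ∫ y, ‖F i y‖)) (fun k => ?_) ?_
    · rw [← integral_const_mul, ← integral_const_mul]
      refine norm_integral_le_of_norm_le (((hFint i).norm.const_mul _).const_mul _) ?_
      refine ae_of_all _ fun y => ?_
      rw [hφd, norm_mul, norm_mul, Real.norm_of_nonneg (hcpos k).le, mul_assoc]
      have := (fderiv ℝ f (c k • y)).le_opNorm (EuclideanSpace.single i 1)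
      have h1 := hK (c k • y)
      have h2 := (hcpos k).le
      gcongr
      simpa using this.trans (by simpa using h1)
    · simpa using hc0.mul_const (K * ∫ y, ‖F i y‖)
  refine tendsto_nhds_unique hlim1 ?_
  simpa only [hparts] using hlim2

lemma norm_sq_eq_sum_sq_apply_single {n : ℕ} (L : EuclideanSpace ℝ (Fin n) →L[ℝ] ℝ) :
    ‖L‖ ^ 2 = ∑ i, L (EuclideanSpace.single i 1) ^ 2 := by
  obtain ⟨v, rfl⟩ := (InnerProductSpace.toDual ℝ (EuclideanSpace ℝ (Fin n))).surjective L
  rw [LinearIsometryEquiv.norm_map, EuclideanSpace.real_norm_sq_eq]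
  simp [InnerProductSpace.toDual_apply_apply, EuclideanSpace.inner_single_right]

lemma apply_eq_sum_mul_apply_single {n : ℕ} (L : EuclideanSpace ℝ (Fin n) →L[ℝ] ℝ)
    (y : EuclideanSpace ℝ (Fin n)) : L y = ∑ i, y i * L (EuclideanSpace.single i 1) := by
  obtain ⟨v, rfl⟩ := (InnerProductSpace.toDual ℝ (EuclideanSpace ℝ (Fin n))).surjective L
  simp [InnerProductSpace.toDual_apply_apply, PiLp.inner_apply]

lemma rho_pos (n : ℕ) (y : EuclideanSpace ℝ (Fin n)) : 0 < rho n y := by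
  unfold rho
  positivity

lemma contDiff_rho (n : ℕ) {k : WithTop ℕ∞} : ContDiff ℝ k (rho n) := by
  unfold rho
  exact contDiff_const.mul (((contDiff_norm_sq ℝ).neg.div_const 4).exp)

lemma integrable_rho (n : ℕ) : Integrable (rho n) := by
  have h := (GaussianFourier.integrable_cexp_neg_mul_sq_norm_add (V := EuclideanSpace ℝ (Fin n))
    (b := ((1 / 4 : ℝ) : ℂ)) (by norm_num) 0 0).norm
  unfold rho
  refine Integrable.const_mul (h.congr (ae_of_all _ fun y => ?_)) _
  simp only [Complex.norm_exp]
  congr 1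
  norm_cast
  simp
  ring

lemma fderiv_rho_apply_single (n : ℕ) (y : EuclideanSpace ℝ (Fin n)) (i : Fin n) :
    fderiv ℝ (rho n) y (EuclideanSpace.single i 1) = -(1 / 2) * y i * rho n y := by
  have h0 : HasFDerivAt (fun z : EuclideanSpace ℝ (Fin n) => -‖z‖ ^ 2 / 4)
      ((4 : ℝ)⁻¹ • -((2 : ℕ) • (innerSL ℝ y : EuclideanSpace ℝ (Fin n) →L[ℝ] ℝ))) y := by
    simpa only [div_eq_mul_inv] using
      ((hasStrictFDerivAt_norm_sq y).hasFDerivAt.fun_neg.mul_const (4 : ℝ)⁻¹)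
  have h2 : HasFDerivAt (rho n) _ y := h0.exp.const_mul ((4 * Real.pi) ^ (-(n : ℝ) / 2))
  rw [h2.fderiv]
  simp [rho, EuclideanSpace.inner_single_right, div_eq_mul_inv]
  ring

/-- Continuous functions of a bounded continuous map are integrable against `rho`. -/
lemma integrable_comp_mul_rho {n : ℕ} {X : Type*} [NormedAddCommGroup X] [ProperSpace X]
    {f : EuclideanSpace ℝ (Fin n) → X} (hf : Continuous f) {M : ℝ} (hM : ∀ y, ‖f y‖ ≤ M)
    {Φ : X → ℝ} (hΦ : Continuous Φ) : Integrable fun y => Φ (f y) * rho n y := by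
  obtain ⟨K, hK⟩ := (isCompact_closedBall (0 : X) M).exists_bound_of_continuousOn hΦ.continuousOn
  exact (integrable_rho n).bdd_mul (hΦ.comp hf).aestronglyMeasurable
    (ae_of_all _ fun y => hK _ (by simpa using hM y))

/-- The weighted integration by parts `∫ u (Δu - (y/2)·∇u) ρ = -∫ |∇u|² ρ`. -/
lemma integral_mul_lap_mul_rho {n : ℕ} {u : EuclideanSpace ℝ (Fin n) → ℝ} (hu : ContDiff ℝ 2 u)
    {M : ℝ} (hM : ∀ y, |u y| ≤ M) (hM' : ∀ y, ‖fderiv ℝ u y‖ ≤ M)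
    (hI : Integrable fun y =>
      (u y * (lap n u y - (1 / 2) * fderiv ℝ u y y) + ‖fderiv ℝ u y‖ ^ 2) * rho n y) :
    ∫ y, (u y * (lap n u y - (1 / 2) * fderiv ℝ u y y) + ‖fderiv ℝ u y‖ ^ 2) * rho n y = 0 := by
  have hu1 : ContDiff ℝ 1 u := hu.of_le (by norm_num)
  have hd : ∀ i : Fin n, ContDiff ℝ 1 fun y => fderiv ℝ u y (EuclideanSpace.single i 1) :=
    fun i => (hu.fderiv_right (m := 1) (by norm_num)).clm_apply contDiff_const
  let F : Fin n → EuclideanSpace ℝ (Fin n) → ℝ := fun i y =>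
    u y * fderiv ℝ u y (EuclideanSpace.single i 1) * rho n y
  have hF : ∀ i, ContDiff ℝ 1 (F i) := fun i => (hu1.mul (hd i)).mul (contDiff_rho n)
  have hFint : ∀ i, Integrable (F i) := by
    intro i
    refine integrable_comp_mul_rho (f := fun y =>
      ((u y, fderiv ℝ u y (EuclideanSpace.single i 1)) : ℝ × ℝ))
      (hu1.continuous.prodMk (hd i).continuous) (M := M) (fun y => ?_)
      (Φ := fun x => x.1 * x.2) (by fun_prop)
    refine max_le (hM y) (((fderiv ℝ u y).le_opNorm _).trans ?_)
    simpa using hM' y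
  have hdiv : ∀ y, (u y * (lap n u y - (1 / 2) * fderiv ℝ u y y) + ‖fderiv ℝ u y‖ ^ 2) * rho n y
      = ∑ i, fderiv ℝ (F i) y (EuclideanSpace.single i 1) := by
    intro y
    rw [apply_eq_sum_mul_apply_single (fderiv ℝ u y) y, norm_sq_eq_sum_sq_apply_single, lap,
      Finset.mul_sum, ← Finset.sum_sub_distrib, Finset.mul_sum, ← Finset.sum_add_distrib,
      Finset.sum_mul]
    refine Finset.sum_congr rfl fun i _ => ?_
    have h1 := (hu1.differentiable one_ne_zero y).hasFDerivAt
    have h2 := ((hd i).differentiable one_ne_zero y).hasFDerivAt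
    have h3 := ((contDiff_rho n (k := 1)).differentiable one_ne_zero y).hasFDerivAt
    have h4 : HasFDerivAt (F i) _ y := (h1.mul h2).mul h3
    rw [h4.fderiv]
    simp [fderiv_rho_apply_single]
    ring
  simp only [hdiv] at hI ⊢
  exact integral_divergence_eq_zero hF hFint hI

lemma log_two_add_sq_pos (z : ℝ) : 0 < Real.log (2 + z ^ 2) :=
  Real.log_pos (by nlinarith [sq_nonneg z])

lemma continuous_hfun {p : ℝ} (a μ : ℝ) (hp : 1 < p) : Continuous (hfun p a μ) := by
  unfold hfun
  have h1 : Continuous fun z : ℝ => |z| ^ (p - 1) :=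
    continuous_abs.rpow_const fun _ => Or.inr (by linarith)
  have h2 : Continuous fun z : ℝ => Real.log (2 + z ^ 2) :=
    Continuous.log (by fun_prop) fun z => by positivity
  have h3 : Continuous fun z : ℝ => Real.log (2 + z ^ 2) ^ a :=
    h2.rpow_const fun z => Or.inl (log_two_add_sq_pos z).ne'
  exact ((continuous_const.mul h1).mul continuous_id).div h3 fun z =>
    (Real.rpow_pos_of_pos (log_two_add_sq_pos z) a).ne'

lemma continuous_Hfun {p : ℝ} (a μ : ℝ) (hp : 1 < p) : Continuous (Hfun p a μ) :=
  intervalIntegral.continuous_primitive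
    (fun _ _ => (continuous_hfun a μ hp).intervalIntegrable _ _) 0

/-- The perturbation `hfun` is of lower order than `|z| ^ p`. -/
lemma exists_abs_hfun_le {p a : ℝ} (μ : ℝ) (hp : 1 < p) (ha : 0 < a) {ε : ℝ} (hε : 0 < ε) :
    ∃ K, 0 ≤ K ∧ ∀ z, |hfun p a μ z| ≤ ε * |z| ^ p + K := by
  have hlim : Tendsto (fun z : ℝ => Real.log (2 + z ^ 2) ^ a) atTop atTop :=
    (tendsto_rpow_atTop ha).comp (Real.tendsto_log_atTop.comp
      (tendsto_atTop_add_const_left _ _ (tendsto_pow_atTop two_ne_zero)))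
  obtain ⟨R, hR⟩ := eventually_atTop.1 (hlim.eventually_ge_atTop (|μ| / ε))
  obtain ⟨K, hK⟩ := (isCompact_Icc (a := -R) (b := R)).exists_bound_of_continuousOn
    (continuous_hfun a μ hp).continuousOn
  refine ⟨max K 0, le_max_right _ _, fun z => ?_⟩
  have hzp : 0 ≤ ε * |z| ^ p := by positivity
  rcases le_total |z| R with hz | hz
  · have := hK z (abs_le.1 hz)
    rw [Real.norm_eq_abs] at this
    linarith [le_max_left K 0]
  · have h1 := hR |z| hz
    rw [sq_abs] at h1
    have hpos := Real.rpow_pos_of_pos (log_two_add_sq_pos z) a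
    have h2 : |z| ^ (p - 1) * |z| = |z| ^ p := by
      rw [← Real.rpow_add_one' (abs_nonneg z) (by linarith)]
      congr 1
      ring
    have h3 : |hfun p a μ z| ≤ ε * |z| ^ p := by
      rw [hfun, abs_div, abs_mul, abs_mul, abs_of_pos hpos, abs_of_nonneg (by positivity :
        0 ≤ |z| ^ (p - 1)), mul_assoc, h2, div_le_iff₀ hpos]
      rw [div_le_iff₀ hε] at h1
      calc |μ| * |z| ^ p ≤ (Real.log (2 + z ^ 2) ^ a * ε) * |z| ^ p := by gcongr
        _ = _ := by ring
    linarith [le_max_right K 0]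

lemma abs_Hfun_le {p a μ ε K : ℝ} (hp : 1 < p) (hε : 0 < ε)
    (h : ∀ z, |hfun p a μ z| ≤ ε * |z| ^ p + K) (z : ℝ) :
    |Hfun p a μ z| ≤ ε * |z| ^ (p + 1) + K * |z| := by
  have h1 : |Hfun p a μ z| ≤ (ε * |z| ^ p + K) * |z - 0| := by
    refine intervalIntegral.norm_integral_le_of_norm_le_const (f := hfun p a μ)
      fun x hx => (h x).trans ?_
    have hx : |x| ≤ |z| := by
      simpa using Set.abs_sub_left_of_mem_uIcc (Set.uIoc_subset_uIcc hx)
    gcongr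
  rw [Real.rpow_add_one' (abs_nonneg z) (by linarith)]
  rw [sub_zero] at h1
  linarith

/-- Quadratic and linear terms are dominated by a higher power. -/
lemma exists_sq_add_abs_le {p A B : ℝ} (hp : 1 < p) (hA : 0 ≤ A) (hB : 0 ≤ B) :
    ∃ K, 0 ≤ K ∧ ∀ x : ℝ, A * x ^ 2 + B * |x| ≤ |x| ^ (p + 1) / 2 + K := by
  obtain ⟨R, hR⟩ := eventually_atTop.1
    ((tendsto_rpow_atTop (sub_pos.2 hp)).eventually_ge_atTop (2 * (A + B)))
  refine ⟨A * R ^ 2 + B * |R| + (A + B), by positivity, fun x => ?_⟩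
  have hxp : 0 ≤ |x| ^ (p + 1) := by positivity
  rw [← sq_abs x, ← sq_abs R]
  have hAR : 0 ≤ A * |R| ^ 2 := by positivity
  have hBR : 0 ≤ B * |R| := by positivity
  rcases le_total |x| |R| with hx | hx
  · have h1 : A * |x| ^ 2 ≤ A * |R| ^ 2 := by gcongr
    have h2 : B * |x| ≤ B * |R| := by gcongr
    linarith
  · have h1 := hR |x| ((le_abs_self R).trans hx)
    have h2 : |x| ^ (p + 1) = |x| ^ (p - 1) * |x| ^ 2 := by
      rw [← Real.rpow_natCast, ← Real.rpow_add' (abs_nonneg x) (by norm_num; linarith)]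
      congr 1
      norm_num
      ring
    rw [h2]
    have h3 : 2 * (A + B) * |x| ^ 2 ≤ |x| ^ (p - 1) * |x| ^ 2 := by gcongr
    have h4 : |x| ≤ |x| ^ 2 + 1 := by nlinarith [sq_nonneg (|x| - 1)]
    have h5 : B * |x| ≤ B * (|x| ^ 2 + 1) := by gcongr
    nlinarith

/-- The rescaled perturbation terms of the equation and of the energy are of lower order. -/
lemma abs_rescaled_le {p a μ ε K s : ℝ} (hp : 1 < p) (hε : 0 < ε) (hK : 0 ≤ K) (hs : 0 ≤ s)
    (h : ∀ z, |hfun p a μ z| ≤ ε * |z| ^ p + K) (x : ℝ) :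
    |x * (Real.exp (-p * s / (p - 1)) * hfun p a μ (Real.exp (s / (p - 1)) * x))|
        ≤ ε * |x| ^ (p + 1) + K * |x| ∧
      |Real.exp (-(p + 1) * s / (p - 1)) * Hfun p a μ (Real.exp (s / (p - 1)) * x)|
        ≤ ε * |x| ^ (p + 1) + K * |x| := by
  have hp1 : 0 < p - 1 := by linarith
  have hpow : ∀ q : ℝ, |Real.exp (s / (p - 1)) * x| ^ q
      = Real.exp (q * s / (p - 1)) * |x| ^ q := by
    intro q
    rw [abs_mul, Real.abs_exp, Real.mul_rpow (Real.exp_pos _).le (abs_nonneg x), ← Real.exp_mul]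
    congr 2
    ring
  have hcancel : ∀ q : ℝ, Real.exp (-q * s / (p - 1)) * Real.exp (q * s / (p - 1)) = 1 := by
    intro q
    rw [← Real.exp_add, ← Real.exp_zero]
    congr 1
    ring
  constructor
  · have h1 := h (Real.exp (s / (p - 1)) * x)
    rw [hpow] at h1
    have h2 : Real.exp (-p * s / (p - 1)) ≤ 1 := by
      rw [Real.exp_le_one_iff]
      exact div_nonpos_of_nonpos_of_nonneg (by nlinarith) hp1.le
    rw [abs_mul, abs_mul, Real.abs_exp, Real.rpow_add_one' (abs_nonneg x) (by linarith)]
    calc |x| * (Real.exp (-p * s / (p - 1)) * |hfun p a μ (Real.exp (s / (p - 1)) * x)|)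
        ≤ |x| * (Real.exp (-p * s / (p - 1)) * (ε * (Real.exp (p * s / (p - 1)) * |x| ^ p) + K)) := by
          gcongr
      _ = (Real.exp (-p * s / (p - 1)) * Real.exp (p * s / (p - 1))) * (ε * (|x| ^ p * |x|))
          + Real.exp (-p * s / (p - 1)) * (K * |x|) := by ring
      _ ≤ 1 * (ε * (|x| ^ p * |x|)) + 1 * (K * |x|) := by
          rw [hcancel]
          gcongr
      _ = _ := by ring
  · have h1 := abs_Hfun_le hp hε h (Real.exp (s / (p - 1)) * x)
    rw [hpow, abs_mul, Real.abs_exp] at h1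
    have h2 : Real.exp (-(p + 1) * s / (p - 1)) * Real.exp (s / (p - 1)) ≤ 1 := by
      rw [← Real.exp_add, Real.exp_le_one_iff, ← add_div]
      exact div_nonpos_of_nonpos_of_nonneg (by nlinarith) hp1.le
    rw [abs_mul, Real.abs_exp]
    calc Real.exp (-(p + 1) * s / (p - 1)) * |Hfun p a μ (Real.exp (s / (p - 1)) * x)|
        ≤ Real.exp (-(p + 1) * s / (p - 1)) * (ε * (Real.exp ((p + 1) * s / (p - 1))
          * |x| ^ (p + 1)) + K * (Real.exp (s / (p - 1)) * |x|)) := by gcongr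
      _ = (Real.exp (-(p + 1) * s / (p - 1)) * Real.exp ((p + 1) * s / (p - 1)))
            * (ε * |x| ^ (p + 1))
          + (Real.exp (-(p + 1) * s / (p - 1)) * Real.exp (s / (p - 1))) * (K * |x|) := by ring
      _ ≤ 1 * (ε * |x| ^ (p + 1)) + 1 * (K * |x|) := by
          rw [hcancel]
          gcongr
      _ = _ := by ring

/-- Control of the `L^(p+1)_ρ` norm by the energy. -/
theorem stmt18 (n : ℕ) (hn : 1 ≤ n) (p : ℝ) (hp : 1 < p)
    (hpS : 3 ≤ n → p < ((n : ℝ) + 2) / ((n : ℝ) - 2)) (a : ℝ) (ha : 0 < a) (μ : ℝ) :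
    ∃ s₁ > (0:ℝ), ∃ C > (0:ℝ),
      ∀ s₀ : ℝ, ∀ w : EuclideanSpace ℝ (Fin n) → ℝ → ℝ,
        SolvesW n p a μ s₀ w → BoundedW n s₀ w →
        ∀ s : ℝ, max s₁ s₀ ≤ s →
          (∫ y, |w y s| ^ (p + 1) * rho n y) ≤
            (4 * (p + 1) / (p - 1)) * Etot n p a μ w s
              + (1 / 2) * (∫ y, (deriv (fun s' => w y s') s) ^ 2 * rho n y) + C := by
  have hp1 : 0 < p - 1 := by linarith
  have hpp : 0 < p + 1 := by linarith
  set c : ℝ := (p + 1) / (p - 1) with hc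
  have hcpos : 0 < c := by positivity
  obtain ⟨K, hK, hh⟩ := exists_abs_hfun_le μ hp ha (ε := 1 / (12 * c)) (by positivity)
  obtain ⟨K', hK', hdom⟩ := exists_sq_add_abs_le (p := p) (A := 2 * c ^ 2) (B := 6 * c * K) hp
    (by positivity) (by positivity)
  have hrho : 0 ≤ ∫ y, rho n y := integral_nonneg fun y => (rho_pos n y).le
  refine ⟨1, one_pos, K' * (∫ y, rho n y) + 1, by positivity, ?_⟩
  rintro s₀ w ⟨hC2, -, heq⟩ hbdd s hs
  obtain ⟨hs1, hs0⟩ := max_le_iff.1 hs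
  obtain ⟨M, hM⟩ := hbdd s (s + 1) hs0 (by linarith)
  replace hM := fun y => hM y s ⟨le_rfl, by linarith⟩
  replace heq := fun y => heq y s hs0
  replace hC2 := hC2 s hs0
  rw [Etot, Enat0, Ipert]
  generalize hws : (fun y => deriv (fun s' => w y s') s) = ws at *
  have hws' : ∀ y, deriv (fun s' => w y s') s = ws y := fun y => congrFun hws y
  simp only [hws'] at *
  generalize hu : (fun y => w y s) = u at *
  have hu' : ∀ y, w y s = u y := fun y => congrFun hu y
  simp only [hu'] at *
  have hlapc : Continuous (lap n u) := by
    unfold lap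
    refine continuous_finsetSum _ fun i _ => ?_
    have h1 : ContDiff ℝ 1 fun y => fderiv ℝ u y (EuclideanSpace.single i 1) :=
      (hC2.fderiv_right (m := 1) (by norm_num)).clm_apply contDiff_const
    exact (h1.continuous_fderiv one_ne_zero).clm_apply continuous_const
  have huc : Continuous u := hC2.continuous
  have hgc : Continuous (fderiv ℝ u) := hC2.continuous_fderiv two_ne_zero
  have hhc := continuous_hfun a μ hp
  have hHc := continuous_Hfun a μ hp
  have hpw : ∀ q : ℝ, 0 < q → Continuous fun x : ℝ => |x| ^ q := fun q hq =>
    continuous_abs.rpow_const fun _ => Or.inr hq.le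
  have hpw1 := hpw (p - 1) hp1
  have hpw2 := hpw (p + 1) hpp
  have hwsc : Continuous ws := by
    rw [funext heq]
    have h1 : Continuous fun y => fderiv ℝ u y y := hgc.clm_apply continuous_id
    have h2 : Continuous fun y => |u y| ^ (p - 1) := hpw1.comp huc
    fun_prop
  let f : EuclideanSpace ℝ (Fin n) → ℝ × ℝ × ℝ := fun y => (u y, ‖fderiv ℝ u y‖, ws y)
  have hfc : Continuous f := huc.prodMk (hgc.norm.prodMk hwsc)
  have hfM : ∀ y, ‖f y‖ ≤ M := fun y =>
    max_le (hM y).1 (max_le (by simpa [f] using (hM y).2.1) (hM y).2.2)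
  have hI : ∀ {Φ : ℝ × ℝ × ℝ → ℝ}, Continuous Φ → Integrable fun y => Φ (f y) * rho n y :=
    fun hΦ => integrable_comp_mul_rho hfc hfM hΦ
  set e₁ := Real.exp (-p * s / (p - 1))
  set e₂ := Real.exp (-(p + 1) * s / (p - 1))
  set e₀ := Real.exp (s / (p - 1))
  have hpw2' : Continuous fun x : ℝ × ℝ × ℝ => |x.1| ^ (p + 1) := hpw2.comp continuous_fst
  let D : ℝ × ℝ × ℝ → ℝ := fun x => x.2.2 * x.1 + x.1 ^ 2 / (p - 1) - |x.1| ^ (p + 1)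
    - x.1 * (e₁ * hfun p a μ (e₀ * x.1)) + x.2.1 ^ 2
  let G : ℝ × ℝ × ℝ → ℝ := fun x => (1 / 2) * x.2.1 ^ 2 + x.1 ^ 2 / (2 * (p - 1))
    - |x.1| ^ (p + 1) / (p + 1)
  let P : ℝ × ℝ × ℝ → ℝ := fun x => Hfun p a μ (e₀ * x.1)
  let N : ℝ × ℝ × ℝ → ℝ := fun x => |x.1| ^ (p + 1)
  let T : ℝ × ℝ × ℝ → ℝ := fun x => x.2.2 ^ 2
  have hDi := hI (Φ := D) (by fun_prop)
  have hGi := hI (Φ := G) (by fun_prop)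
  have hPi := hI (Φ := P) (by fun_prop)
  have hNi := hI (Φ := N) hpw2'
  have hTi := hI (Φ := T) (by fun_prop)
  have hDeq : ∀ y, D (f y) =
      u y * (lap n u y - (1 / 2) * fderiv ℝ u y y) + ‖fderiv ℝ u y‖ ^ 2 := by
    intro y
    have h1 : |u y| ^ (p + 1) = |u y| ^ (p - 1) * u y ^ 2 := by
      rw [← sq_abs (u y), ← Real.rpow_natCast, ← Real.rpow_add' (abs_nonneg _)
        (by norm_num; linarith)]
      congr 1
      norm_num
      ring
    simp only [D, f, heq y, h1]
    ring
  have hD0 : ∫ y, D (f y) * rho n y = 0 := by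
    simp only [hDeq] at hDi ⊢
    exact integral_mul_lap_mul_rho hC2 (fun y => (hM y).1) (fun y => (hM y).2.1) hDi
  have hpoint : ∀ x, N x ≤ 4 * c * (G x - e₂ * P x) + (1 / 2) * T x - 2 * c * D x + K' := by
    rintro ⟨x, g, t⟩
    obtain ⟨h1, h2⟩ := abs_rescaled_le (s := s) hp (by positivity) hK (by linarith) hh x
    have h3 := hdom x
    have h4 := neg_le_of_abs_le h1
    have h5 := le_of_abs_le h2
    simp only [N, G, P, T, D]
    change -_ ≤ x * (e₁ * hfun p a μ (e₀ * x)) at h4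
    change e₂ * Hfun p a μ (e₀ * x) ≤ _ at h5
    set X := |x| ^ (p + 1)
    set Q := e₂ * Hfun p a μ (e₀ * x)
    set R := x * (e₁ * hfun p a μ (e₀ * x))
    have h6 : 4 * c * Q ≤ 4 * c * (1 / (12 * c) * X + K * |x|) := by gcongr
    have h7 : 2 * c * -(1 / (12 * c) * X + K * |x|) ≤ 2 * c * R := by gcongr
    have h8 : c * (1 / (12 * c) * X) = X / 12 := by field_simp
    have h9 : c * (X - 2 * X / (p + 1)) = X := by rw [hc]; field_simp; ring
    have h10 : 4 * c * (1 / 2 * g ^ 2 + x ^ 2 / (2 * (p - 1)) - X / (p + 1) - Q) + 1 / 2 * t ^ 2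
        - 2 * c * (t * x + x ^ 2 / (p - 1) - X - R + g ^ 2)
        = 2 * (c * (X - 2 * X / (p + 1))) - 4 * c * Q + 2 * c * R + 1 / 2 * (t - 2 * c * x) ^ 2
          - 2 * c ^ 2 * x ^ 2 := by
      field_simp
      ring
    rw [h10, h9]
    nlinarith [sq_nonneg (t - 2 * c * x)]
  have hi1 : Integrable fun y => 4 * c * (G (f y) * rho n y - e₂ * (P (f y) * rho n y)) :=
    (hGi.sub (hPi.const_mul _)).const_mul _
  have hi2 : Integrable fun y => 4 * c * (G (f y) * rho n y - e₂ * (P (f y) * rho n y))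
      + (1 / 2) * (T (f y) * rho n y) := hi1.add (hTi.const_mul _)
  have hi3 : Integrable fun y => 4 * c * (G (f y) * rho n y - e₂ * (P (f y) * rho n y))
      + (1 / 2) * (T (f y) * rho n y) - 2 * c * (D (f y) * rho n y) := hi2.sub (hDi.const_mul _)
  have hi4 := (integrable_rho n).const_mul K'
  have hmono : ∫ y, N (f y) * rho n y ≤ ∫ y, (4 * c * (G (f y) * rho n y
      - e₂ * (P (f y) * rho n y)) + (1 / 2) * (T (f y) * rho n y)
      - 2 * c * (D (f y) * rho n y) + K' * rho n y) := by
    refine integral_mono hNi (hi3.add hi4) fun y => ?_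
    have := mul_le_mul_of_nonneg_right (hpoint (f y)) (rho_pos n y).le
    dsimp only at this ⊢
    linarith
  rw [integral_add hi3 hi4, integral_sub hi2 (hDi.const_mul _),
    integral_add hi1 (hTi.const_mul _), integral_const_mul, integral_const_mul,
    integral_const_mul, integral_const_mul, integral_sub hGi (hPi.const_mul _),
    integral_const_mul, hD0] at hmono
  have hc4 : 4 * (p + 1) / (p - 1) = 4 * c := by rw [hc]; ring
  rw [hc4]
  simp only [N, G, P, T, f] at hmono
  linarith
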